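/- arXiv:1608.02472 — 2 statements merged into one kernel-verified Lean document; each statement's English description precedes it below -/
import Mathlib

section
/- Let p, q be coprime integers with 0 < p < q, let p/q = [a_0, a_1, \ldots, a_n] be a continued fraction expansion of p/q with all a_i positive integers for i \geq 1, and let p_{n-1}/q_{n-1} = [a_0, \ldots, a_{n-1}] be the (n-1)-st convergent. If n is even, then 12 s(p,q) = (p - q_{n-1})/q + \sum_{i=1}^{n} (-1)^{i+1} a_i; if n is odd, then 12 s(p,q) = (p + q_{n-1})/q + \sum_{i=1}^{n} (-1)^{i+1} a_i - 3. -/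
/-- The sawtooth function `((x))`. -/
noncomputable def sawtooth (x : ℝ) : ℝ :=
  if Int.fract x = 0 then 0 else Int.fract x - 1/2

/-- The classical Dedekind sum `s(p,q)`. -/
noncomputable def dedekindSum (p q : ℕ) : ℝ :=
  ∑ k ∈ Finset.range q, sawtooth (k / q) * sawtooth (p * k / q)

/-- Convergents of the continued fraction `[a 0; a 1, ..., a n]`, indexed with a shift:
`convergent a 0 = (p₋₁, q₋₁) = (1, 0)`, `convergent a 1 = (p₀, q₀) = (a 0, 1)`, and
`convergent a (k+2) = (p_{k+1}, q_{k+1}) = a (k+1) • (p_k, q_k) + (p_{k-1}, q_{k-1})`. -/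
def convergent (a : ℕ → ℤ) : ℕ → ℤ × ℤ
  | 0 => (1, 0)
  | 1 => (a 0, 1)
  | (k+2) => (a (k+1) * (convergent a (k+1)).1 + (convergent a k).1,
              a (k+1) * (convergent a (k+1)).2 + (convergent a k).2)

lemma sawtooth_add_int (x : ℝ) (m : ℤ) : sawtooth (x + m) = sawtooth x := by
  simp [sawtooth, Int.fract_add_intCast]

lemma sawtooth_neg (x : ℝ) : sawtooth (-x) = - sawtooth x := by
  unfold sawtooth
  by_cases h : Int.fract x = 0
  · simp [h, Int.fract_neg_eq_zero]
  · rw [if_neg h, if_neg (by rwa [Int.fract_neg_eq_zero]), Int.fract_neg h]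
    ring

/-- value of the sawtooth at an integer fraction depends on the numerator mod `q` -/
lemma sawtooth_congr (q : ℕ) (hq : 0 < q) (x y : ℤ) (h : (q : ℤ) ∣ x - y) :
    sawtooth ((x : ℝ) / q) = sawtooth ((y : ℝ) / q) := by
  obtain ⟨c, hc⟩ := h
  have hx : x = y + q * c := by linarith
  have hq' : (q : ℝ) ≠ 0 := by positivity
  have : (x : ℝ) / q = (y : ℝ) / q + c := by
    rw [hx]; push_cast; field_simp
  rw [this, sawtooth_add_int]

lemma sum_perm (r q : ℕ) (hq : 0 < q) (hc : Nat.Coprime r q) (F : ℕ → ℝ) :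
    ∑ k ∈ Finset.range q, F (r * k % q) = ∑ k ∈ Finset.range q, F k := by
  have hmaps : Set.MapsTo (fun k => r * k % q) (Finset.range q : Set ℕ) (Finset.range q) := by
    intro k _
    simpa using Nat.mod_lt _ hq
  have hinj : Set.InjOn (fun k => r * k % q) (Finset.range q : Set ℕ) := by
    intro x hx y hy hxy
    have h1 : r * x ≡ r * y [MOD q] := hxy
    have h2 : x ≡ y [MOD q] := Nat.ModEq.cancel_left_of_coprime (by simpa [Nat.gcd_comm] using hc) h1
    simp at hx hy
    exact Nat.ModEq.eq_of_lt_of_lt h2 hx hy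
  refine Finset.sum_nbij (fun k => r * k % q) (fun k hk => hmaps hk) hinj ?_ (fun _ _ => rfl)
  exact Finset.surjOn_of_injOn_of_card_le _ hmaps hinj le_rfl

lemma dedekind_inv (p r q : ℕ) (hq : 0 < q) (hc : Nat.Coprime r q) (e : ℤ)
    (he : e = 1 ∨ e = -1) (h : (q : ℤ) ∣ (p : ℤ) * r - e) :
    dedekindSum p q = e * dedekindSum r q := by
  unfold dedekindSum
  rw [← sum_perm r q hq hc, Finset.mul_sum]
  refine Finset.sum_congr rfl fun k _ => ?_
  have hmod : (q : ℤ) ∣ ((r * k % q : ℕ) : ℤ) - (r * k : ℤ) := by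
    have := Int.mod_modEq ((r : ℤ) * k) q
    have := this.symm.dvd
    push_cast
    exact this
  have h1 : sawtooth (((r * k % q : ℕ) : ℝ) / q) = sawtooth ((r : ℝ) * k / q) := by
    have := sawtooth_congr q hq _ _ hmod
    push_cast at this ⊢
    exact this
  have h2 : sawtooth ((p : ℝ) * ((r * k % q : ℕ) : ℝ) / q) = e * sawtooth ((k : ℝ) / q) := by
    have h3 : (q : ℤ) ∣ (p : ℤ) * ((r * k % q : ℕ) : ℤ) - e * k := by
      have : (p : ℤ) * ((r * k % q : ℕ) : ℤ) - e * k
        = p * (((r * k % q : ℕ) : ℤ) - (r * k : ℤ)) + (p * r - e) * k := by ring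
      rw [this]
      exact dvd_add (Dvd.dvd.mul_left hmod _) (Dvd.dvd.mul_right h _)
    have h4 := sawtooth_congr q hq _ _ h3
    rw [Int.cast_mul, Int.cast_natCast, Int.cast_natCast] at h4
    rw [h4]
    rcases he with rfl | rfl
    · simp
    · have : (((-1 * (k : ℤ) : ℤ)) : ℝ) / q = - ((k : ℝ) / q) := by push_cast; ring
      rw [this, sawtooth_neg]; simp
  rw [h1, h2]; ring

lemma sawtooth_div (m k : ℕ) (hk : 0 < k) (h : ¬ k ∣ m) :
    sawtooth ((m : ℝ) / k) = (m : ℝ) / k - ((m / k : ℕ) : ℝ) - 1 / 2 := by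
  have hf : Int.fract ((m : ℝ) / k) = (m : ℝ) / k - ((m / k : ℕ) : ℝ) := by
    rw [Int.fract]
    have : ⌊(m : ℝ) / k⌋ = ((m / k : ℕ) : ℤ) := by
      rw [← Nat.floor_div_eq_div (K := ℝ), Int.natCast_floor_eq_floor (by positivity)]
    rw [this, Int.cast_natCast]
  unfold sawtooth
  have hne : Int.fract ((m : ℝ) / k) ≠ 0 := by
    rw [hf]
    intro h0
    apply h
    have hk' : (k : ℝ) ≠ 0 := by positivity
    have : (m : ℝ) = k * ((m / k : ℕ) : ℝ) := by
      field_simp at h0; linarith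
    exact ⟨m / k, by exact_mod_cast this⟩
  rw [if_neg hne, hf]

lemma dedekind_floor (h k : ℕ) (hk : 0 < k) (hc : Nat.Coprime h k) :
    dedekindSum h k = ∑ j ∈ Finset.range k,
      ((j : ℝ) / k - 1 / 2) * ((h : ℝ) * j / k - ((h * j / k : ℕ) : ℝ) - 1 / 2) - 1 / 4 := by
  obtain ⟨k, rfl⟩ : ∃ k', k = k' + 1 := ⟨k - 1, by omega⟩
  unfold dedekindSum
  rw [Finset.sum_range_succ', Finset.sum_range_succ']
  have h0 : sawtooth 0 = 0 := by simp [sawtooth]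
  have : ∀ j ∈ Finset.range k, sawtooth (((j + 1 : ℕ) : ℝ) / (k + 1 : ℕ)) *
      sawtooth ((h : ℝ) * ((j + 1 : ℕ) : ℝ) / (k + 1 : ℕ)) =
      (((j + 1 : ℕ) : ℝ) / (k + 1 : ℕ) - 1 / 2) *
      ((h : ℝ) * ((j + 1 : ℕ) : ℝ) / (k + 1 : ℕ) - ((h * (j + 1) / (k + 1) : ℕ) : ℝ) - 1 / 2) := by
    intro j hj
    have hj' : j < k := by simpa using hj
    have hnd : ¬ (k + 1) ∣ (j + 1) := fun hd => by
      have := Nat.le_of_dvd (by omega) hd; omega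
    have hnd2 : ¬ (k + 1) ∣ h * (j + 1) := fun hd => hnd (hc.symm.dvd_of_dvd_mul_left hd)
    have e1 := sawtooth_div _ _ hk hnd
    have e2 := sawtooth_div _ _ hk hnd2
    rw [Nat.cast_mul] at e2
    rw [e1, e2, Nat.div_eq_of_lt (by omega : j + 1 < k + 1)]
    simp
  rw [Finset.sum_congr rfl this]
  simp [h0]
  norm_num

lemma sum_id (k : ℕ) : ∑ j ∈ Finset.range k, (j : ℝ) = k * (k - 1) / 2 := by
  induction k with
  | zero => simp
  | succ k ih => rw [Finset.sum_range_succ, ih]; push_cast; ring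

lemma sum_sq (k : ℕ) : ∑ j ∈ Finset.range k, (j : ℝ) ^ 2 = k * (k - 1) * (2 * k - 1) / 6 := by
  induction k with
  | zero => simp
  | succ k ih => rw [Finset.sum_range_succ, ih]; push_cast; ring

lemma floor_swap (h k : ℕ) (hh : 0 < h) (hk : 0 < k) (hc : Nat.Coprime h k) :
    ∑ j ∈ Finset.range k, ((h * j / k : ℕ) : ℝ) * (((h * j / k : ℕ) : ℝ) + 1) =
    ∑ v ∈ Finset.range h, 2 * (v : ℝ) * ((k : ℝ) - 1 - ((k * v / h : ℕ) : ℝ)) := by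
  have hL : ∀ j ∈ Finset.range k, ((h * j / k : ℕ) : ℝ) * (((h * j / k : ℕ) : ℝ) + 1) =
      ∑ v ∈ Finset.range h, if v * k ≤ h * j then 2 * (v : ℝ) else 0 := by
    intro j hj
    have hj' : j < k := by simpa using hj
    rw [← Finset.sum_filter]
    have : (Finset.range h).filter (fun v => v * k ≤ h * j) = Finset.range (h * j / k + 1) := by
      ext v
      simp only [Finset.mem_filter, Finset.mem_range, Nat.lt_succ_iff, Nat.le_div_iff_mul_le hk]
      constructor
      · exact fun h => h.2
      · intro hv
        refine ⟨?_, hv⟩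
        by_contra hcon
        have : h * k ≤ v * k := Nat.mul_le_mul_right _ (by omega)
        have : h * j < h * k := Nat.mul_lt_mul_of_pos_left hj' hh
        omega
    rw [this, ← Finset.mul_sum, sum_id]
    push_cast; ring
  rw [Finset.sum_congr rfl hL, Finset.sum_comm]
  refine Finset.sum_congr rfl fun v hv => ?_
  have hv' : v < h := by simpa using hv
  rcases Nat.eq_zero_or_pos v with rfl | hvpos
  · simp
  rw [← Finset.sum_filter]
  have hlt : k * v / h < k := by
    rw [Nat.div_lt_iff_lt_mul hh]
    exact Nat.mul_lt_mul_of_pos_left hv' hk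
  have : (Finset.range k).filter (fun j => v * k ≤ h * j) = Finset.Ico (k * v / h + 1) k := by
    ext j
    simp only [Finset.mem_filter, Finset.mem_range, Finset.mem_Ico, Nat.succ_le_iff,
      Nat.div_lt_iff_lt_mul hh]
    rw [and_comm]
    refine and_congr_left fun _ => ?_
    rw [Nat.mul_comm v k, Nat.mul_comm h j]
    refine ⟨fun hle => lt_of_le_of_ne hle ?_, le_of_lt⟩
    intro heq
    have : h ∣ k * v := ⟨j, by rw [heq, Nat.mul_comm]⟩
    have := Nat.le_of_dvd hvpos (hc.dvd_of_dvd_mul_left this)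
    omega
  rw [this, Finset.sum_const, Nat.card_Ico, nsmul_eq_mul, Nat.cast_sub (by omega)]
  push_cast; ring

lemma dedekind_expand (h k : ℕ) (hk : 0 < k) (hc : Nat.Coprime h k) :
    dedekindSum h k = (h : ℝ) * (k - 1) * (2 * k - 1) / (6 * k)
      - (∑ j ∈ Finset.range k, (j : ℝ) * ((h * j / k : ℕ) : ℝ)) / k
      - (k - 1) / 4 - (k - 1) / 4 + k / 4 - 1 / 4 := by
  have hk' : (k : ℝ) ≠ 0 := by positivity
  have key : ∀ j : ℕ, ((h * j % k : ℕ) : ℝ) = h * j - k * ((h * j / k : ℕ) : ℝ) := by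
    intro j
    have := Nat.mod_add_div (h * j) k
    have : ((h * j % k : ℕ) : ℝ) + k * ((h * j / k : ℕ) : ℝ) = h * j := by exact_mod_cast this
    linarith
  have hE := sum_perm h k hk hc (fun j => (j : ℝ))
  have hterm : ∀ j ∈ Finset.range k,
      ((j : ℝ) / k - 1 / 2) * ((h : ℝ) * j / k - ((h * j / k : ℕ) : ℝ) - 1 / 2) =
      (h / k ^ 2 : ℝ) * (j : ℝ) ^ 2 - (1 / k) * ((j : ℝ) * ((h * j / k : ℕ) : ℝ))
      - (1 / (2 * k)) * j - (1 / (2 * k)) * ((h * j % k : ℕ) : ℝ) + 1 / 4 := by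
    intro j _
    rw [key]; field_simp; ring
  rw [dedekind_floor h k hk hc, Finset.sum_congr rfl hterm]
  simp only [Finset.sum_add_distrib, Finset.sum_sub_distrib, ← Finset.mul_sum]
  rw [hE, sum_id, sum_sq]
  simp only [Finset.sum_const, Finset.card_range, nsmul_eq_mul]
  field_simp; ring

lemma reciprocity (h k : ℕ) (hh : 0 < h) (hk : 0 < k) (hc : Nat.Coprime h k) :
    12 * (dedekindSum h k + dedekindSum k h) =
      -3 + (h : ℝ) / k + (k : ℝ) / h + 1 / ((h : ℝ) * k) := by
  have hk' : (k : ℝ) ≠ 0 := by positivity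
  have hh' : (h : ℝ) ≠ 0 := by positivity
  have key : ∀ j : ℕ, ((h * j % k : ℕ) : ℝ) = h * j - k * ((h * j / k : ℕ) : ℝ) := by
    intro j
    have := Nat.mod_add_div (h * j) k
    have : ((h * j % k : ℕ) : ℝ) + k * ((h * j / k : ℕ) : ℝ) = h * j := by exact_mod_cast this
    linarith
  have E1 := sum_perm h k hk hc (fun j => (j : ℝ) ^ 2)
  have E2 := sum_perm h k hk hc (fun j => (j : ℝ))
  have E3 := floor_swap h k hh hk hc
  rw [dedekind_expand h k hk hc, dedekind_expand k h hh hc.symm]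
  have t1 : ∀ j ∈ Finset.range k, ((h * j % k : ℕ) : ℝ) ^ 2 =
      (h : ℝ) ^ 2 * (j : ℝ) ^ 2 - 2 * h * k * ((j : ℝ) * ((h * j / k : ℕ) : ℝ))
      + k ^ 2 * ((h * j / k : ℕ) : ℝ) ^ 2 := by
    intro j _; rw [key]; ring
  have t2 : ∀ j ∈ Finset.range k, ((h * j % k : ℕ) : ℝ) =
      h * j - k * ((h * j / k : ℕ) : ℝ) := fun j _ => key j
  have t3 : ∀ j ∈ Finset.range k, ((h * j / k : ℕ) : ℝ) * (((h * j / k : ℕ) : ℝ) + 1) =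
      ((h * j / k : ℕ) : ℝ) ^ 2 + ((h * j / k : ℕ) : ℝ) := by intro j _; ring
  have t4 : ∀ v ∈ Finset.range h, 2 * (v : ℝ) * ((k : ℝ) - 1 - ((k * v / h : ℕ) : ℝ)) =
      2 * ((k : ℝ) - 1) * v - 2 * ((v : ℝ) * ((k * v / h : ℕ) : ℝ)) := by intro j _; ring
  rw [Finset.sum_congr rfl t1] at E1
  rw [Finset.sum_congr rfl t2] at E2
  rw [Finset.sum_congr rfl t3, Finset.sum_congr rfl t4] at E3
  simp only [Finset.sum_add_distrib, Finset.sum_sub_distrib, ← Finset.mul_sum, sum_id, sum_sq]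
    at E1 E2 E3
  generalize ∑ j ∈ Finset.range k, (j : ℝ) * ((h * j / k : ℕ) : ℝ) = A at *
  generalize ∑ j ∈ Finset.range h, (j : ℝ) * ((k * j / h : ℕ) : ℝ) = B at *
  generalize ∑ j ∈ Finset.range k, ((h * j / k : ℕ) : ℝ) ^ 2 = S at *
  generalize ∑ j ∈ Finset.range k, ((h * j / k : ℕ) : ℝ) = R at *
  have hR : R = (h - 1) * (k - 1) / 2 := by
    have : (k : ℝ) * R = k * ((h - 1) * (k - 1) / 2) := by linarith
    exact mul_left_cancel₀ hk' this
  have hS : S = 2 * (k - 1) * (h * (h - 1) / 2) - 2 * B - R := by linarith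
  have hA : A = ((h : ℝ) ^ 2 * (k * (k - 1) * (2 * k - 1) / 6) + k ^ 2 * S
      - k * (k - 1) * (2 * k - 1) / 6) / (2 * h * k) := by
    rw [eq_div_iff (by positivity)]; linarith
  rw [hA, hS, hR]
  field_simp; ring

lemma dedekind_congr (p r q : ℕ) (hq : 0 < q) (h : (q : ℤ) ∣ (p : ℤ) - r) :
    dedekindSum p q = dedekindSum r q := by
  unfold dedekindSum
  refine Finset.sum_congr rfl fun k _ => ?_
  have := sawtooth_congr q hq ((p : ℤ) * k) ((r : ℤ) * k)
    (by rw [← sub_mul]; exact Dvd.dvd.mul_right h _)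
  push_cast at this
  rw [this]

lemma conv_det (a : ℕ → ℤ) (k : ℕ) :
    (convergent a (k + 1)).1 * (convergent a k).2 - (convergent a k).1 * (convergent a (k + 1)).2
      = (-1) ^ (k + 1) := by
  induction k with
  | zero => simp [convergent]
  | succ k ih =>
    rw [convergent, pow_succ, ← ih]; ring

lemma conv_pos (a : ℕ → ℤ) (n : ℕ) (ha : ∀ i, 1 ≤ i → i ≤ n → 0 < a i) (k : ℕ) (hk : k ≤ n) :
    0 ≤ (convergent a k).2 ∧ 0 < (convergent a (k + 1)).2 := by
  induction k with
  | zero => simp [convergent]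
  | succ k ih =>
    obtain ⟨h1, h2⟩ := ih (by omega)
    refine ⟨h2.le, ?_⟩
    rw [convergent]
    have := ha (k + 1) (by omega) hk
    positivity

lemma conv_bound (a : ℕ → ℤ) (n : ℕ) (ha : ∀ i, 1 ≤ i → i ≤ n → 0 < a i) (k : ℕ) (hk : k ≤ n) :
    0 ≤ (convergent a k).1 - a 0 * (convergent a k).2 ∧
    0 ≤ (convergent a (k + 1)).1 - a 0 * (convergent a (k + 1)).2 ∧
    (convergent a (k + 1)).1 ≤ (a 0 + 1) * (convergent a (k + 1)).2 ∧
    (1 ≤ k → (convergent a k).1 ≤ (a 0 + 1) * (convergent a k).2) := by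
  induction k with
  | zero => simp [convergent]
  | succ k ih =>
    obtain ⟨h1, h2, h3, h4⟩ := ih (by omega)
    have hp := ha (k + 1) (by omega) hk
    refine ⟨h2, ?_, ?_, fun _ => h3⟩
    · rw [convergent]; dsimp only
      have := mul_nonneg hp.le h2
      nlinarith
    · rcases Nat.eq_zero_or_pos k with rfl | hkp
      · simp [convergent] at hp ⊢; nlinarith
      · have h4 := h4 hkp
        rw [convergent]; dsimp only
        have := mul_nonneg hp.le (sub_nonneg.2 h3)
        nlinarith

lemma conv_coprime (a : ℕ → ℤ) (k : ℕ) :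
    IsCoprime (convergent a k).2 (convergent a (k + 1)).2 := by
  have h := conv_det a k
  rcases neg_one_pow_eq_or ℤ (k + 1) with e | e <;> rw [e] at h
  · exact ⟨(convergent a (k + 1)).1, -(convergent a k).1, by linarith⟩
  · exact ⟨-(convergent a (k + 1)).1, (convergent a k).1, by linarith⟩

lemma conv_dedekind (a : ℕ → ℤ) (n : ℕ) (ha : ∀ i, 1 ≤ i → i ≤ n → 0 < a i) (k : ℕ)
    (hk : k ≤ n) :
    12 * (-1) ^ (k + 1) *
      dedekindSum (convergent a k).2.toNat (convergent a (k + 1)).2.toNat =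
    (-1) ^ (k + 1) * ((convergent a k).2 : ℝ) / (convergent a (k + 1)).2
      + ((convergent a (k + 1)).1 : ℝ) / (convergent a (k + 1)).2 - a 0
      + ∑ i ∈ Finset.Icc 1 k, (-1 : ℝ) ^ (i + 1) * (a i : ℝ) - 3 * (1 - (-1) ^ k) / 2 := by
  induction k with
  | zero => simp [convergent, dedekindSum, sawtooth]
  | succ k ih =>
    have ih := ih (by omega)
    obtain ⟨h1, h2⟩ := conv_pos a n ha k (by omega)
    obtain ⟨_, h3⟩ := conv_pos a n ha (k + 1) hk
    have hdet := conv_det a (k + 1)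
    have hcop := conv_coprime a (k + 1)
    have hdetR : ((convergent a (k + 2)).1 : ℝ) * (convergent a (k + 1)).2 -
      (convergent a (k + 1)).1 * (convergent a (k + 2)).2 = (-1) ^ (k + 2) := by
      exact_mod_cast hdet
    have hrec : (convergent a (k + 2)).2 =
      a (k + 1) * (convergent a (k + 1)).2 + (convergent a k).2 := by rw [convergent]
    have hrecR : ((convergent a (k + 2)).2 : ℝ) =
      a (k + 1) * (convergent a (k + 1)).2 + (convergent a k).2 := by exact_mod_cast hrec
    rw [Finset.sum_Icc_succ_top (by omega)]
    change 0 < (convergent a (k + 2)).2 at h3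
    change 12 * (-1) ^ (k + 2) *
      dedekindSum (convergent a (k + 1)).2.toNat (convergent a (k + 2)).2.toNat =
      (-1) ^ (k + 2) * ((convergent a (k + 1)).2 : ℝ) / (convergent a (k + 2)).2
      + ((convergent a (k + 2)).1 : ℝ) / (convergent a (k + 2)).2 - a 0
      + (∑ i ∈ Finset.Icc 1 k, (-1 : ℝ) ^ (i + 1) * (a i : ℝ) + (-1) ^ (k + 2) * a (k + 1))
      - 3 * (1 - (-1) ^ (k + 1)) / 2
    change IsCoprime (convergent a (k + 1)).2 (convergent a (k + 2)).2 at hcop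
    clear hdet
    generalize (convergent a (k + 2)).1 = P2 at *
    generalize (convergent a (k + 1)).1 = P1 at *
    generalize (convergent a (k + 2)).2 = Q2 at *
    generalize (convergent a (k + 1)).2 = Q1 at *
    generalize (convergent a k).2 = Q0 at *
    lift Q2 to ℕ using h3.le
    lift Q1 to ℕ using h2.le
    lift Q0 to ℕ using h1
    simp only [Int.toNat_natCast, Int.cast_natCast] at *
    have hQ1 : 0 < Q1 := by exact_mod_cast h2
    have hQ2 : 0 < Q2 := by exact_mod_cast h3
    have hrc := reciprocity Q1 Q2 hQ1 hQ2 (Nat.isCoprime_iff_coprime.1 hcop)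
    rw [dedekind_congr Q2 Q0 Q1 hQ1 ⟨a (k + 1), by rw [hrec]; ring⟩] at hrc
    have hr1 : (Q1 : ℝ) ≠ 0 := by positivity
    have hr2 : (Q2 : ℝ) ≠ 0 := by positivity
    generalize dedekindSum Q1 Q2 = D2 at *
    generalize dedekindSum Q0 Q1 = D1 at *
    generalize ∑ i ∈ Finset.Icc 1 k, (-1 : ℝ) ^ (i + 1) * (a i : ℝ) = S at *
    have hdiv : (P2 : ℝ) / Q2 = P1 / Q1 + (-1) ^ (k + 2) / (Q1 * Q2) := by
      rw [← hdetR]; field_simp; ring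
    have hq : (Q2 : ℝ) / Q1 = a (k + 1) + Q0 / Q1 := by
      rw [hrecR]; field_simp
    rw [hq] at hrc
    rw [hdiv]
    have hD2 : 12 * D2 = -3 + Q1 / Q2 + (a (k + 1) + Q0 / Q1) + 1 / (Q1 * Q2) - 12 * D1 := by
      linarith
    rw [show (12 : ℝ) * (-1) ^ (k + 2) * D2 = (-1) ^ (k + 2) * (12 * D2) by ring, hD2]
    simp only [pow_succ] at ih ⊢
    linear_combination ih

theorem hickerson_formula (p q : ℕ) (hp : 0 < p) (hpq : p < q) (hcop : Nat.Coprime p q)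
    (n : ℕ) (a : ℕ → ℤ) (ha : ∀ i, 1 ≤ i → i ≤ n → 0 < a i)
    (hconv : convergent a (n + 1) = ((p : ℤ), (q : ℤ))) :
    (Even n →
      12 * dedekindSum p q =
        ((p : ℝ) - ((convergent a n).2 : ℝ)) / q +
          ∑ i ∈ Finset.Icc 1 n, (-1 : ℝ)^(i+1) * (a i : ℝ)) ∧
    (Odd n →
      12 * dedekindSum p q =
        ((p : ℝ) + ((convergent a n).2 : ℝ)) / q +
          ∑ i ∈ Finset.Icc 1 n, (-1 : ℝ)^(i+1) * (a i : ℝ) - 3) := by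
  have hq : 0 < q := by omega
  have main := conv_dedekind a n ha n le_rfl
  have hdet := conv_det a n
  have hco := conv_coprime a n
  obtain ⟨_, hb1, hb2, _⟩ := conv_bound a n ha n le_rfl
  obtain ⟨hnn, _⟩ := conv_pos a n ha n le_rfl
  rw [hconv] at main hdet hco hb1 hb2
  dsimp only at main hdet hco hb1 hb2
  have hpZ : (0 : ℤ) < p := by exact_mod_cast hp
  have hqZ : (0 : ℤ) < q := by exact_mod_cast hq
  have hpqZ : (p : ℤ) < q := by exact_mod_cast hpq
  have ha0 : a 0 = 0 := by
    have l1 : a 0 < 1 := by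
      by_contra hcon
      nlinarith
    have l2 : -1 < a 0 := by
      by_contra hcon
      nlinarith
    omega
  rw [ha0] at main
  generalize (convergent a n).2 = r at *
  lift r to ℕ using hnn
  simp only [Int.toNat_natCast, Int.cast_natCast] at *
  have hinv := dedekind_inv p r q hq (Nat.isCoprime_iff_coprime.1 hco) ((-1) ^ (n + 1))
    (neg_one_pow_eq_or ℤ _) ⟨(convergent a n).1, by rw [← hdet]; ring⟩
  push_cast at hinv
  rw [mul_assoc, ← hinv] at main
  constructor
  · intro he
    rw [main, pow_succ, he.neg_one_pow]; push_cast; ring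
  · intro ho
    rw [main, pow_succ, ho.neg_one_pow]; push_cast; ring
end

section
/- For coprime positive integers p, q with p < q, and positive integers i, j with i + j = N \geq 2 even, let R_N = \binom{N}{i}\beta_N r_N where \beta_N is the denominator of the Bernoulli number B_N in lowest terms and r_N is the least common multiple over odd i' with 0 \leq i' \leq N-2 of the denominators of \beta_N \binom{N}{i'+1} B_{i'+1} B_{N-i'-1}. If p' is any integer with p p' \equiv 1 \pmod q, then R_N q^{N-2} s_{i,j}(p,q) - \alpha_N r_N \frac{\binom{N-1}{i}(p')^i + \binom{N-1}{j}p^j}{q} is an integer, where \alpha_N is the numerator of B_N. -/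
/-- The `m`-th periodic Bernoulli function. -/
noncomputable def periodicBernoulli (m : ℕ) (x : ℝ) : ℝ :=
  if m = 1 ∧ Int.fract x = 0 then 0
  else Polynomial.eval (Int.fract x) ((Polynomial.bernoulli m).map (algebraMap ℚ ℝ))

/-- The generalized Dedekind sum `s_{i,j}(p,q)`. -/
noncomputable def genDedekindSum (i j p q : ℕ) : ℝ :=
  ∑ k ∈ Finset.range q, periodicBernoulli i (k / q) * periodicBernoulli j (p * k / q)

/-- `r N` is the l.c.m. over odd `i'` with `0 ≤ i' ≤ N-2` of the denominators of
`β_N ⬝ C(N, i'+1) ⬝ B_{i'+1} ⬝ B_{N-i'-1}`, where `β_N` is the denominator of `B_N`. -/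
def rLcm (N : ℕ) : ℕ :=
  Finset.lcm ((Finset.range (N - 1)).filter (fun i => Odd i))
    (fun i => ((((bernoulli N).den : ℚ) * (N.choose (i + 1) : ℚ) *
      bernoulli (i + 1) * bernoulli (N - i - 1)).den))


namespace JunLee

open Finset

section Comb

theorem comb_aux {R : Type*} [CommRing R] (u v : R) (p q : ℕ) (hp : 0 < p) (hq : 0 < q) (c : ℕ) :
    (u - 1) * v * ∑ k ∈ range ((q * c + (p - 1)) / p), u ^ k * v ^ (p * k / q) =
      (1 - v) * ∑ d ∈ range c, u ^ ((q * d + (p - 1)) / p) * v ^ d +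
        u ^ ((q * c + (p - 1)) / p) * v ^ c - 1 := by
  induction c with
  | zero =>
    have : (q * 0 + (p - 1)) / p = 0 := Nat.div_eq_of_lt (by omega)
    rw [this]; simp
  | succ c ih =>
    have hle : (q * c + (p - 1)) / p ≤ (q * (c + 1) + (p - 1)) / p :=
      Nat.div_le_div_right (by nlinarith)
    rw [← sum_range_add_sum_Ico _ hle, mul_add, ih, sum_range_succ]
    have h1 : ∑ k ∈ Ico ((q * c + (p - 1)) / p) ((q * (c + 1) + (p - 1)) / p),
        u ^ k * v ^ (p * k / q) =
        (∑ k ∈ Ico ((q * c + (p - 1)) / p) ((q * (c + 1) + (p - 1)) / p), u ^ k) * v ^ c := by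
      rw [sum_mul]
      refine sum_congr rfl fun k hk => ?_
      rw [mem_Ico] at hk
      obtain ⟨h1, h2⟩ := hk
      have h3 : p * k / q = c := by
        have h2' : k + 1 ≤ (q * (c + 1) + (p - 1)) / p := h2
        rw [Nat.le_div_iff_mul_le hp] at h2'
        have h1' : q * c + (p - 1) < (k + 1) * p := by
          rw [← Nat.div_lt_iff_lt_mul hp]; omega
        apply Nat.div_eq_of_lt_le
        · have : c * q = q * c := mul_comm _ _
          have : (k + 1) * p = p * k + p := by ring
          omega
        · have : (c + 1) * q = q * (c + 1) := mul_comm _ _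
          have : (k + 1) * p = p * k + p := by ring
          omega
      rw [h3]
    have h2 := geom_sum_Ico_mul u hle
    rw [h1]
    generalize (∑ k ∈ Ico ((q * c + (p - 1)) / p) ((q * (c + 1) + (p - 1)) / p), u ^ k) = S at *
    linear_combination v * v ^ c * h2

theorem comb {R : Type*} [CommRing R] (u v : R) (p q : ℕ) (hp : 0 < p) (hq : 0 < q) :
    (u - 1) * v * ∑ k ∈ range q, u ^ k * v ^ (p * k / q) =
      (1 - v) * ∑ d ∈ range p, u ^ ((q * d + (p - 1)) / p) * v ^ d + u ^ q * v ^ p - 1 := by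
  have h : (q * p + (p - 1)) / p = q := by
    apply Nat.div_eq_of_lt_le
    · omega
    · have : (q + 1) * p = q * p + p := by ring
      omega
  have := comb_aux u v p q hp hq p
  rwa [h] at this

theorem fract1 (p q k : ℕ) (hq : 0 < q) :
    Int.fract (((p : ℤ) : ℚ) * k / q) = (p : ℚ) * k / q - ((p * k / q : ℕ) : ℚ) := by
  have : ⌊((p : ℤ) : ℚ) * k / q⌋ = ((p * k / q : ℕ) : ℤ) := by
    have := Rat.floor_intCast_div_natCast ((p * k : ℕ) : ℤ) q
    push_cast at this ⊢
    exact this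
  rw [Int.fract, this, Int.cast_natCast, Int.cast_natCast]

theorem fract2 (p q c : ℕ) (hp : 0 < p) :
    Int.fract (((-(q : ℤ) : ℤ) : ℚ) * c / p) =
      (((q * c + (p - 1)) / p : ℕ) : ℚ) - (q : ℚ) * c / p := by
  have hp' : (0 : ℚ) < p := by exact_mod_cast hp
  have : ⌊((-(q : ℤ) : ℤ) : ℚ) * c / p⌋ = -(((q * c + (p - 1)) / p : ℕ) : ℤ) := by
    rw [Int.floor_eq_iff]
    set m := (q * c + (p - 1)) / p with hm
    have h1 : q * c ≤ m * p := by
      have : q * c + (p - 1) < (m + 1) * p := by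
        rw [← Nat.div_lt_iff_lt_mul hp]; omega
      have h2 : (m + 1) * p = m * p + p := by ring
      omega
    have h2 : m * p < q * c + p := by
      have : m * p ≤ q * c + (p - 1) := Nat.div_mul_le_self _ _
      omega
    have h1' : (q : ℚ) * c ≤ m * p := by exact_mod_cast h1
    have h2' : (m : ℚ) * p < q * c + p := by exact_mod_cast h2
    constructor
    · rw [le_div_iff₀ hp']; push_cast; linarith
    · rw [div_lt_iff₀ hp']; push_cast; linarith
  rw [Int.fract, this, Int.cast_neg, Int.cast_neg, Int.cast_natCast, Int.cast_natCast]; ring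

end Comb

section Series

variable {A : Type*} [CommRing A] [Algebra ℚ A]

/-- The exponential series `exp (a t)`. -/
noncomputable def E (a : A) : PowerSeries A := PowerSeries.rescale a (PowerSeries.exp A)

theorem E_add (a b : A) : E (a + b) = E a * E b :=
  (PowerSeries.exp_mul_exp_eq_exp_add a b).symm

theorem E_zero : E (0 : A) = 1 := by
  simp [E, PowerSeries.rescale_zero]

theorem E_nat (n : ℕ) (a : A) : E (n * a) = E a ^ n := by
  induction n with
  | zero => simp [E_zero]
  | succ n ih => rw [pow_succ, ← ih, ← E_add]; congr 1; push_cast; ring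

theorem E_ne_one [IsDomain A] {a : A} (ha : a ≠ 0) : E a - 1 ≠ 0 := by
  intro h
  have := congrArg (PowerSeries.coeff 1) h
  simp [E, PowerSeries.coeff_rescale, PowerSeries.coeff_exp, PowerSeries.coeff_one] at this
  exact ha this

/-- Generating series of the numbers `B_n(x) X^n / n!`. -/
noncomputable def bs (x : ℚ) (X : A) : PowerSeries A :=
  PowerSeries.mk fun n =>
    algebraMap ℚ A ((Polynomial.bernoulli n).eval x / (n.factorial : ℚ)) * X ^ n

theorem bs_mul (x : ℚ) (X : A) :
    bs x X * (E X - 1) = PowerSeries.C X * PowerSeries.X * E (algebraMap ℚ A x * X) := by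
  have h := congrArg (PowerSeries.rescale X)
    (Polynomial.bernoulli_generating_function (algebraMap ℚ A x))
  have h1 : PowerSeries.rescale X (PowerSeries.mk fun n =>
      Polynomial.aeval (algebraMap ℚ A x) ((1 / (n.factorial : ℚ)) • Polynomial.bernoulli n)) =
      bs x X := by
    ext n
    rw [PowerSeries.coeff_rescale, bs, PowerSeries.coeff_mk, PowerSeries.coeff_mk,
      Polynomial.aeval_algebraMap_apply, mul_comm]
    congr 2
    simp [div_eq_inv_mul]
  rw [map_mul, map_sub, map_one, h1, map_mul, PowerSeries.rescale_rescale] at h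
  rw [E, E, h]
  congr 1
  ext n
  simp [PowerSeries.coeff_X, PowerSeries.coeff_C_mul]

/-- Uncorrected Dedekind sums. -/
noncomputable def sQ (i j : ℕ) (p : ℤ) (q : ℕ) : ℚ :=
  ∑ k ∈ range q, (Polynomial.bernoulli i).eval (Int.fract ((k : ℚ) / q)) *
    (Polynomial.bernoulli j).eval (Int.fract ((p : ℚ) * k / q))

/-- Homogeneous polynomial collecting the Dedekind sums of weight `N`. -/
noncomputable def D (N : ℕ) (p : ℤ) (q : ℕ) (X Y : A) : A :=
  ∑ x ∈ HasAntidiagonal.antidiagonal N, algebraMap ℚ A (N.choose x.1 * sQ x.1 x.2 p q) * X ^ x.1 * Y ^ x.2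

/-- Generating series of `D`. -/
noncomputable def DS (p : ℤ) (q : ℕ) (X Y : A) : PowerSeries A :=
  ∑ k ∈ range q, bs (Int.fract ((k : ℚ) / q)) X * bs (Int.fract ((p : ℚ) * k / q)) Y

theorem coeff_DS (N : ℕ) (p : ℤ) (q : ℕ) (X Y : A) :
    algebraMap ℚ A N.factorial * PowerSeries.coeff N (DS p q X Y) = D N p q X Y := by
  rw [DS, D, map_sum]
  simp only [PowerSeries.coeff_mul, bs, PowerSeries.coeff_mk]
  rw [sum_comm, mul_sum]
  refine sum_congr rfl fun x hx => ?_
  rw [HasAntidiagonal.mem_antidiagonal] at hx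
  rw [sQ, mul_sum, mul_sum, map_sum, sum_mul, sum_mul]
  refine sum_congr rfl fun k hk => ?_
  generalize Polynomial.eval _ (Polynomial.bernoulli x.1) = a
  generalize Polynomial.eval _ (Polynomial.bernoulli x.2) = b
  have h : ((N.choose x.1 : ℚ) * (a * b)) =
      N.factorial * (a / x.1.factorial) * (b / x.2.factorial) := by
    have h1 := Nat.add_choose_mul_factorial_mul_factorial x.1 x.2
    rw [hx, ← Nat.choose_symm_of_eq_add hx.symm] at h1
    rw [← h1]
    have := Nat.factorial_ne_zero x.1
    have := Nat.factorial_ne_zero x.2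
    push_cast
    field_simp
  rw [h, map_mul, map_mul]
  ring

theorem DS_mul (p : ℤ) (q : ℕ) (X Y : A) :
    DS p q X Y * (E X - 1) * (E Y - 1) =
      PowerSeries.C X * PowerSeries.C Y * PowerSeries.X ^ 2 *
        ∑ k ∈ range q, E (algebraMap ℚ A (Int.fract ((k : ℚ) / q)) * X +
          algebraMap ℚ A (Int.fract ((p : ℚ) * k / q)) * Y) := by
  rw [DS, sum_mul, sum_mul, mul_sum]
  refine sum_congr rfl fun k hk => ?_
  have h1 := bs_mul (Int.fract ((k : ℚ) / q)) X
  have h2 := bs_mul (Int.fract ((p : ℚ) * k / q)) Y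
  rw [E_add]
  calc _ = (bs (Int.fract ((k : ℚ) / q)) X * (E X - 1)) *
      (bs (Int.fract ((p : ℚ) * k / q)) Y * (E Y - 1)) := by ring
    _ = _ := by rw [h1, h2]; ring

theorem fract_small (k q : ℕ) (h : k < q) : Int.fract ((k : ℚ) / q) = k / q := by
  have hq : (0 : ℚ) < q := by exact_mod_cast (by omega : 0 < q)
  rw [Int.fract_eq_self]
  exact ⟨by positivity, by rw [div_lt_one hq]; exact_mod_cast h⟩

theorem reciprocity_series [IsDomain A] (p q : ℕ) (hp : 0 < p) (hq : 0 < q) (X Y Z : A)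
    (hX : X ≠ 0) (hY : Y ≠ 0) (hZ : Z ≠ 0) (h : X = q * Z - p * Y) :
    PowerSeries.C Z * DS p q X Y = PowerSeries.C Y * DS (-(q : ℤ)) p X Z +
      PowerSeries.C X * DS 0 1 Z Y +
        PowerSeries.C X * PowerSeries.C Y * PowerSeries.X * bs 0 Z := by
  have e1 : ∀ k ∈ range q, E (algebraMap ℚ A (Int.fract ((k : ℚ) / q)) * X +
      algebraMap ℚ A (Int.fract (((p : ℤ) : ℚ) * k / q)) * Y) =
      E Z ^ k * E (-Y) ^ (p * k / q) := by
    intro k hk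
    rw [fract1 p q k hq, fract_small k q (mem_range.1 hk), ← E_nat, ← E_nat, ← E_add]
    congr 1
    have hq' : (q : ℚ) ≠ 0 := by exact_mod_cast hq.ne'
    have h2 : algebraMap ℚ A ((k : ℚ) / q) * q = k := by
      rw [← map_natCast (algebraMap ℚ A) q, ← map_mul, div_mul_cancel₀ _ hq', map_natCast]
    have h3 : algebraMap ℚ A ((p : ℚ) * k / q) = p * algebraMap ℚ A ((k : ℚ) / q) := by
      rw [mul_div_assoc, map_mul, map_natCast]
    rw [map_sub, h3, map_natCast, h]
    linear_combination Z * h2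
  have e2 : ∀ c ∈ range p, E (algebraMap ℚ A (Int.fract ((c : ℚ) / p)) * X +
      algebraMap ℚ A (Int.fract (((-(q : ℤ) : ℤ) : ℚ) * c / p)) * Z) =
      E Z ^ ((q * c + (p - 1)) / p) * E (-Y) ^ c := by
    intro c hc
    rw [fract2 p q c hp, fract_small c p (mem_range.1 hc), ← E_nat, ← E_nat, ← E_add]
    congr 1
    have hp' : (p : ℚ) ≠ 0 := by exact_mod_cast hp.ne'
    have h2 : algebraMap ℚ A ((c : ℚ) / p) * p = c := by
      rw [← map_natCast (algebraMap ℚ A) p, ← map_mul, div_mul_cancel₀ _ hp', map_natCast]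
    have h3 : algebraMap ℚ A ((q : ℚ) * c / p) = q * algebraMap ℚ A ((c : ℚ) / p) := by
      rw [mul_div_assoc, map_mul, map_natCast]
    rw [map_sub, h3, map_natCast, h]
    linear_combination (-Y) * h2
  have d1 := DS_mul (p : ℤ) q X Y
  have d2 := DS_mul (-(q : ℤ)) p X Z
  have d3 := DS_mul 0 1 Z Y
  have d4 := bs_mul 0 Z
  rw [sum_congr rfl e1] at d1
  rw [sum_congr rfl e2] at d2
  simp [E_zero] at d3
  simp [E_zero] at d4
  have hc := comb (E Z) (E (-Y)) p q hp hq
  have hv : E Y * E (-Y) = 1 := by rw [← E_add, add_neg_cancel, E_zero]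
  have hEX : E X = E Z ^ q * E (-Y) ^ p := by
    rw [← E_nat, ← E_nat, ← E_add, h]; congr 1; ring
  have nX := E_ne_one hX
  have nY := E_ne_one hY
  have nZ := E_ne_one hZ
  apply mul_right_cancel₀ (mul_ne_zero (mul_ne_zero nX nY) nZ)
  set S1 := ∑ k ∈ range q, E Z ^ k * E (-Y) ^ (p * k / q)
  set S2 := ∑ c ∈ range p, E Z ^ ((q * c + (p - 1)) / p) * E (-Y) ^ c
  have key : (E Z - 1) * S1 = (E Y - 1) * S2 + (E X - 1) * E Y := by
    rw [hEX]
    linear_combination E Y * hc - ((E Z - 1) * S1 + S2) * hv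
  linear_combination PowerSeries.C Z * (E Z - 1) * d1 - PowerSeries.C Y * (E Y - 1) * d2
    - PowerSeries.C X * (E X - 1) * d3
    - PowerSeries.C X * PowerSeries.C Y * PowerSeries.X * (E X - 1) * (E Y - 1) * d4
    + PowerSeries.C X * PowerSeries.C Y * PowerSeries.C Z * PowerSeries.X ^ 2 * key

theorem reciprocity [IsDomain A] (N p q : ℕ) (hN : 1 ≤ N) (hp : 0 < p) (hq : 0 < q) (X Y Z : A)
    (hX : X ≠ 0) (hY : Y ≠ 0) (hZ : Z ≠ 0) (h : X = q * Z - p * Y) :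
    Z * D N p q X Y = Y * D N (-(q : ℤ)) p X Z + X * D N 0 1 Z Y +
        X * Y * (algebraMap ℚ A (N * bernoulli (N - 1)) * Z ^ (N - 1)) := by
  have h1 := congrArg (PowerSeries.coeff N) (reciprocity_series p q hp hq X Y Z hX hY hZ h)
  obtain ⟨n, rfl⟩ : ∃ n, N = n + 1 := ⟨N - 1, by omega⟩
  rw [mul_assoc (PowerSeries.C X * PowerSeries.C Y), mul_assoc (PowerSeries.C X)] at h1
  simp only [map_add, PowerSeries.coeff_C_mul, PowerSeries.coeff_succ_X_mul] at h1
  simp only [← coeff_DS]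
  rw [bs, PowerSeries.coeff_mk, Polynomial.bernoulli_eval_zero] at h1
  have h2 : algebraMap ℚ A (((n + 1 : ℕ) : ℚ) * bernoulli (n + 1 - 1)) =
      algebraMap ℚ A (n + 1).factorial * algebraMap ℚ A (bernoulli n / n.factorial) := by
    rw [← map_mul]
    congr 1
    have := Nat.factorial_ne_zero n
    rw [Nat.factorial_succ, Nat.add_sub_cancel]
    push_cast
    field_simp
  rw [h2, Nat.add_sub_cancel]
  linear_combination algebraMap ℚ A (n + 1).factorial * h1

end Series

set_option linter.unusedSectionVars false

section Integrality

theorem exists_int_of_den_dvd (x : ℚ) (r : ℕ) (h : x.den ∣ r) : ∃ m : ℤ, (r : ℚ) * x = m := by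
  obtain ⟨c, rfl⟩ := h
  refine ⟨c * x.num, ?_⟩
  have := Rat.mul_den_eq_num x
  push_cast
  rw [← this]; ring

theorem coef_int (N i j : ℕ) (hN : Even N) (hi : 1 ≤ i) (hj : 1 ≤ j) (hij : i + j = N) :
    ∃ m : ℤ, ((bernoulli N).den : ℚ) * rLcm N * (N.choose i * (bernoulli i * bernoulli j)) = m := by
  by_cases h2 : N = 2
  · obtain rfl : i = 1 := by omega
    obtain rfl : j = 1 := by omega
    subst h2
    refine ⟨3 * rLcm 2, ?_⟩
    have : (bernoulli 2).den = 6 := by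
      rw [bernoulli_two]; norm_num
    rw [this, bernoulli_one]
    norm_num
    ring
  · rcases Nat.even_or_odd i with he | ho
    · have h1 : i - 1 + 1 = i := by omega
      have h3 : N - (i - 1) - 1 = j := by omega
      have hdvd : (((bernoulli N).den : ℚ) * (N.choose i : ℚ) * bernoulli i * bernoulli j).den ∣
          rLcm N := by
        have := Finset.dvd_lcm (s := (Finset.range (N - 1)).filter (fun i => Odd i))
          (f := (fun i => ((((bernoulli N).den : ℚ) * (N.choose (i + 1) : ℚ) *
            bernoulli (i + 1) * bernoulli (N - i - 1)).den))) (b := i - 1) (by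
              rw [mem_filter, mem_range]
              exact ⟨by omega, by rw [Nat.even_iff] at he; rw [Nat.odd_iff]; omega⟩)
        simp only [h1, h3] at this
        exact this
      obtain ⟨m, hm⟩ := exists_int_of_den_dvd _ _ hdvd
      exact ⟨m, by rw [← hm]; ring⟩
    · refine ⟨0, ?_⟩
      have hoj : Odd j := by
        rw [Nat.odd_iff] at *; rw [Nat.even_iff] at hN; omega
      by_cases h1 : i = 1
      · rw [bernoulli_eq_zero_of_odd hoj (by omega)]; simp
      · rw [bernoulli_eq_zero_of_odd ho (by omega)]; simp

theorem corr_int (N : ℕ) (hN : Even N) (h2 : 2 ≤ N) :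
    ∃ m : ℤ, ((bernoulli N).den : ℚ) * rLcm N * (N * bernoulli (N - 1)) = m := by
  by_cases h : N = 2
  · subst h
    refine ⟨-((bernoulli 2).den * rLcm 2), ?_⟩
    norm_num [bernoulli_one]
  · refine ⟨0, ?_⟩
    have ho : Odd (N - 1) := by
      rw [Nat.even_iff] at hN; rw [Nat.odd_iff]; omega
    rw [bernoulli_eq_zero_of_odd ho (by omega)]
    simp

theorem sQ_one (i j : ℕ) (p : ℤ) : sQ i j p 1 = bernoulli i * bernoulli j := by
  simp [sQ]

variable {A : Type*} [CommRing A] [Algebra ℚ A]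

theorem pow_mul_mem (L : Submodule ℤ A) {X Y : A} (hX : X ∈ L) (hY : Y ∈ L) (a b n : ℕ)
    (h : a + b = n) : X ^ a * Y ^ b ∈ L ^ n := by
  rw [← h, pow_add]
  exact Submodule.mul_mem_mul (Submodule.pow_mem_pow _ hX _) (Submodule.pow_mem_pow _ hY _)

theorem int_mul_mem (M : Submodule ℤ A) {x : A} (hx : x ∈ M) (m : ℤ) : (m : A) * x ∈ M := by
  rw [← zsmul_eq_mul]; exact M.smul_mem m hx

theorem geom (L : Submodule ℤ A) {x y : A} (hx : x ∈ L) (hy : y ∈ L) (n : ℕ) :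
    ∃ G ∈ L ^ n, x ^ (n + 1) - y ^ (n + 1) = (x - y) * G := by
  refine ⟨∑ i ∈ range (n + 1), x ^ i * y ^ (n - i), ?_, ?_⟩
  · refine Submodule.sum_mem _ fun i hi => pow_mul_mem L hx hy _ _ _ ?_
    rw [mem_range] at hi; omega
  · rw [mul_comm, ← geom_sum₂_mul]; rfl

theorem base (n : ℕ) (hN : Even (n + 2)) (p : ℤ) (L : Submodule ℤ A) {X Y : A} (hX : X ∈ L)
    (hY : Y ∈ L) : ∃ P ∈ L ^ n,
      algebraMap ℚ A ((bernoulli (n + 2)).den * rLcm (n + 2)) * D (n + 2) p 1 X Y =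
        (((bernoulli (n + 2)).num * rLcm (n + 2) : ℤ) : A) * (X ^ (n + 2) + Y ^ (n + 2)) +
          X * Y * P := by
  have hc : ∀ k : ℕ, ∃ m : ℤ, k ∈ range (n + 1) → ((bernoulli (n + 2)).den : ℚ) * rLcm (n + 2) *
      ((n + 2).choose (k + 1) * (bernoulli (k + 1) * bernoulli (n + 1 - k))) = m := by
    intro k
    by_cases hk : k ∈ range (n + 1)
    · rw [mem_range] at hk
      obtain ⟨m, hm⟩ := coef_int (n + 2) (k + 1) (n + 1 - k) hN (by omega) (by omega) (by omega)
      exact ⟨m, fun _ => hm⟩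
    · exact ⟨0, fun h => absurd h hk⟩
  choose m hm using hc
  refine ⟨∑ k ∈ range (n + 1), (m k : A) * (X ^ k * Y ^ (n - k)), ?_, ?_⟩
  · refine Submodule.sum_mem _ fun i hi => int_mul_mem _ (pow_mul_mem L hX hY _ _ _ ?_) _
    rw [mem_range] at hi; omega
  · have hB : algebraMap ℚ A ((bernoulli (n + 2)).den * rLcm (n + 2)) *
        algebraMap ℚ A (bernoulli (n + 2)) =
        (((bernoulli (n + 2)).num * rLcm (n + 2) : ℤ) : A) := by
      rw [← map_mul, ← map_intCast (algebraMap ℚ A)]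
      congr 1
      have := Rat.mul_den_eq_num (bernoulli (n + 2))
      push_cast
      rw [← this]; ring
    rw [D, Finset.Nat.sum_antidiagonal_eq_sum_range_succ_mk, sum_range_succ, sum_range_succ',
      mul_sum, mul_add, mul_add, mul_sum]
    have hs : ∀ k ∈ range (n + 1), algebraMap ℚ A ((bernoulli (n + 2)).den * rLcm (n + 2)) *
        (algebraMap ℚ A ((n + 2).choose (k + 1) * sQ (k + 1) (n + 2 - (k + 1)) p 1) *
          X ^ (k + 1) * Y ^ (n + 2 - (k + 1))) = X * Y * ((m k : A) * (X ^ k * Y ^ (n - k))) := by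
      intro k hk
      have h1 := congrArg (algebraMap ℚ A) (hm k hk)
      rw [map_mul, map_intCast] at h1
      have hk' := mem_range.1 hk
      have h3 : n + 2 - (k + 1) = n + 1 - k := by omega
      have h4 : Y ^ (n + 1 - k) = Y ^ (n - k) * Y := by
        rw [← pow_succ]; congr 1; omega
      rw [sQ_one, h3, h4, ← h1]
      ring
    rw [sum_congr rfl hs]
    simp only [sQ_one, Nat.choose_zero_right, Nat.choose_self, Nat.sub_zero, Nat.sub_self,
      bernoulli_zero, Nat.cast_one, one_mul, mul_one, pow_zero]
    rw [← hB]
    ring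

theorem D_mod (N : ℕ) (p t : ℤ) (q : ℕ) (hq : 0 < q) (X Y : A) :
    D N (p + q * t) q X Y = D N p q X Y := by
  have hq' : (q : ℚ) ≠ 0 := by exact_mod_cast hq.ne'
  have : ∀ i j, sQ i j (p + q * t) q = sQ i j p q := by
    intro i j
    unfold sQ
    refine sum_congr rfl fun k _ => ?_
    have : (((p + q * t : ℤ) : ℚ) * k / q) = (p : ℚ) * k / q + ((t * k : ℤ) : ℚ) := by
      push_cast; field_simp
    rw [this, Int.fract_add_intCast]
  simp only [D, this]

theorem main [IsDomain A] (n : ℕ) (hN : Even (n + 2)) (q : ℕ) : 0 < q → ∀ p pt e : ℤ,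
    p * pt - q * e = 1 → ∀ X Y Z : A,
    (∀ a b : ℤ, (a : A) * X + b * Y = 0 → a = 0 ∧ b = 0) → X = q * Z - p * Y →
    ∀ L : Submodule ℤ A, Y ∈ L → Z ∈ L → ∃ P ∈ L ^ n,
      algebraMap ℚ A ((bernoulli (n + 2)).den * rLcm (n + 2)) * D (n + 2) p q X Y =
        (((bernoulli (n + 2)).num * rLcm (n + 2) : ℤ) : A) *
          (Y * (pt * Z - e * Y) ^ (n + 1) + X * Z ^ (n + 1)) + X * Y * P := by
  induction q using Nat.strong_induction_on with
  | _ q ih =>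
  intro hq p pt e hpe X Y Z hind hX L hY hZ
  set a : ℤ := (bernoulli (n + 2)).num * rLcm (n + 2) with ha
  by_cases hq1 : q = 1
  · subst hq1
    have hXL : X ∈ L := by
      rw [hX, Nat.cast_one, one_mul]
      exact L.sub_mem hZ (int_mul_mem _ hY _)
    obtain ⟨P, hP, h⟩ := base n hN p L hXL hY
    rw [← ha] at h
    have he : pt * Z - e * Y = (pt : A) * X + Y := by
      have : (e : A) = p * pt - 1 := by
        have : e = p * pt - 1 := by push_cast at hpe; linarith
        rw [this]; push_cast; ring
      rw [this, hX]; push_cast; ring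
    have hWL : (pt : A) * X + Y ∈ L := L.add_mem (int_mul_mem _ hXL _) hY
    obtain ⟨G, hG, h1⟩ := geom L hWL hY n
    obtain ⟨G', hG', h2⟩ := geom L hZ hXL n
    refine ⟨P - a * (pt * G + p * G'), ?_, ?_⟩
    · exact Submodule.sub_mem _ hP (int_mul_mem _
        (Submodule.add_mem _ (int_mul_mem _ hG _) (int_mul_mem _ hG' _)) _)
    · rw [h, he]
      have hZX : Z - X = p * Y := by rw [hX]; push_cast; ring
      rw [hZX] at h2
      linear_combination -(a : A) * Y * h1 - (a : A) * X * h2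
  · -- reduction of `p`
    obtain ⟨p0, hp0⟩ : ∃ p0 : ℕ, (p0 : ℤ) = p % q :=
      ⟨(p % q).toNat, Int.toNat_of_nonneg (Int.emod_nonneg _ (by omega))⟩
    set t : ℤ := p / q with ht
    have hpt : p = p0 + q * t := by rw [hp0, ht]; exact (Int.emod_add_mul_ediv p q).symm
    have hlt : p0 < q := by
      have := Int.emod_lt_of_pos p (by omega : (0 : ℤ) < q)
      omega
    have hpos : 0 < p0 := by
      rcases Nat.eq_zero_or_pos p0 with h | h
      · exfalso
        rw [h] at hpt
        have h1 : (q : ℤ) ∣ 1 := ⟨t * pt - e, by rw [← hpe, hpt]; push_cast; ring⟩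
        have h2 : q ∣ 1 := by exact_mod_cast h1
        exact hq1 (Nat.dvd_one.1 h2)
      · exact h
    set Z0 : A := Z - t * Y with hZ0
    have hZ0L : Z0 ∈ L := L.sub_mem hZ (int_mul_mem _ hY _)
    have hX0 : X = q * Z0 - p0 * Y := by
      rw [hX, hZ0, hpt]; push_cast; ring
    have hXne : X ≠ 0 := by
      intro h; have := (hind 1 0 (by simp [h])).1; omega
    have hYne : Y ≠ 0 := by
      intro h; have := (hind 0 1 (by simp [h])).2; omega
    have hZne : Z0 ≠ 0 := by
      intro h
      rw [h] at hX0
      have := (hind 1 p0 (by rw [hX0]; push_cast; ring)).1; omega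
    have hrec := reciprocity (n + 2) p0 q (by omega) hpos hq X Y Z0 hXne hYne hZne hX0
    obtain ⟨P1, hP1, h1⟩ := ih p0 hlt hpos (-(q : ℤ)) (e - t * pt) (-pt)
      (by rw [← hpe, hpt]; ring) X Z0 (-Y) (by
        intro c d hcd
        have := hind (q * c + d) (d * p0) (by
          push_cast
          linear_combination (q : A) * hcd + (d : A) * hX0)
        obtain ⟨h1, h2⟩ := this
        have hd : d = 0 := by
          rcases mul_eq_zero.1 h2 with h | h
          · exact h
          · omega
        subst hd
        refine ⟨?_, rfl⟩
        rw [add_zero] at h1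
        rcases mul_eq_zero.1 h1 with h | h
        · omega
        · exact h) (by rw [hX0]; push_cast; ring) L hZ0L (L.neg_mem hY)
    obtain ⟨P2, hP2, h2⟩ := base n hN 0 L hZ0L hY
    obtain ⟨m, hm⟩ := corr_int (n + 2) hN (by omega)
    obtain ⟨G, hG, hg⟩ := geom L hZ hZ0L n
    rw [← ha] at h2
    have hm' := congrArg (algebraMap ℚ A) hm
    rw [map_mul, map_intCast] at hm'
    refine ⟨P1 + P2 + m * Z0 ^ n - a * (t * G), ?_, ?_⟩
    · exact Submodule.sub_mem _ (Submodule.add_mem _ (Submodule.add_mem _ hP1 hP2)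
        (int_mul_mem _ (Submodule.pow_mem_pow _ hZ0L _) _))
        (int_mul_mem _ (int_mul_mem _ hG _) _)
    · apply mul_left_cancel₀ hZne
      have hodd : Odd (n + 1) := by
        rw [Nat.even_iff] at hN; rw [Nat.odd_iff]; omega
      have hW : ((e - t * pt : ℤ) : A) * (-Y) - ((-pt : ℤ) : A) * Z0 = pt * Z - e * Y := by
        rw [hZ0]; push_cast; ring
      rw [hW, hodd.neg_pow] at h1
      have hZZ : Z - Z0 = t * Y := by rw [hZ0]; ring
      rw [hZZ] at hg
      have hD : D (n + 2) p q X Y = D (n + 2) p0 q X Y := by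
        rw [hpt]; exact D_mod _ _ _ _ hq _ _
      rw [hD]
      have e1 : n + 2 - 1 = n + 1 := rfl
      rw [e1] at hrec hm'
      linear_combination (algebraMap ℚ A ((bernoulli (n + 2)).den * rLcm (n + 2))) * hrec
        + Y * h1 + X * h2 + X * Y * Z0 ^ (n + 1) * hm' - (a : A) * X * Z0 * hg

end Integrality

section Final

open Polynomial in
/-- Polynomials whose product with `q` has integer coefficients. -/
noncomputable def Lq (q : ℕ) : Submodule ℤ ℚ[X] where
  carrier := {f | ∃ g : ℤ[X], C (q : ℚ) * f = g.map (Int.castRingHom ℚ)}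
  add_mem' := by
    rintro f f' ⟨g, hg⟩ ⟨g', hg'⟩
    exact ⟨g + g', by rw [mul_add, hg, hg', Polynomial.map_add]⟩
  zero_mem' := ⟨0, by simp⟩
  smul_mem' := by
    rintro c f ⟨g, hg⟩
    refine ⟨c • g, ?_⟩
    rw [zsmul_eq_mul, zsmul_eq_mul, Polynomial.map_mul, ← hg, Polynomial.map_intCast]
    ring

open Polynomial in
theorem Lq_pow (q n : ℕ) (f : ℚ[X]) (hf : f ∈ Lq q ^ n) :
    ∃ g : ℤ[X], C (q : ℚ) ^ n * f = g.map (Int.castRingHom ℚ) := by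
  induction hf using Submodule.pow_induction_on_left' with
  | algebraMap r => exact ⟨C r, by simp⟩
  | add x y i hx hy h1 h2 =>
    obtain ⟨g, hg⟩ := h1
    obtain ⟨g', hg'⟩ := h2
    exact ⟨g + g', by rw [mul_add, hg, hg', Polynomial.map_add]⟩
  | mem_mul m hm i x hx h =>
    obtain ⟨g, hg⟩ := h
    obtain ⟨g', hg'⟩ := hm
    exact ⟨g' * g, by rw [Polynomial.map_mul, ← hg, ← hg', Nat.succ_eq_add_one, pow_succ]; ring⟩

open Polynomial in
theorem final_rat (n i k q : ℕ) (p pt : ℤ) (hN : Even (n + 2)) (hq : 0 < q)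
    (hik : i + k = n + 1) (hpp : (p * pt) % q = 1 % q) : ∃ m : ℤ,
    ((n + 2).choose i : ℚ) * (_root_.bernoulli (n + 2)).den * rLcm (n + 2) * (q : ℚ) ^ n *
      sQ i (k + 1) p q - (_root_.bernoulli (n + 2)).num * rLcm (n + 2) *
        ((n + 1).choose i * (pt : ℚ) ^ i + (n + 1).choose (k + 1) * (p : ℚ) ^ (k + 1)) / q = m := by
  have hq' : (q : ℚ) ≠ 0 := by exact_mod_cast hq.ne'
  obtain ⟨e, he⟩ : ∃ e : ℤ, p * pt - q * e = 1 := by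
    have h1 : (q : ℤ) ∣ p * pt - 1 := Int.ModEq.dvd (Int.ModEq.symm hpp)
    obtain ⟨e, he⟩ := h1
    exact ⟨e, by linarith⟩
  set Z : ℚ[X] := C (q : ℚ)⁻¹ * (1 + C (p : ℚ) * X) with hZ
  have hCq : C (q : ℚ) * C (q : ℚ)⁻¹ = 1 := by rw [← C_mul, mul_inv_cancel₀ hq', C_1]
  have hqn : ((q : ℕ) : ℚ[X]) = C (q : ℚ) := by simp
  have hpn : ((p : ℤ) : ℚ[X]) = C (p : ℚ) := by simp
  have hptn : ((pt : ℤ) : ℚ[X]) = C (pt : ℚ) := by simp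
  have hX : (1 : ℚ[X]) = (q : ℚ[X]) * Z - (p : ℚ[X]) * X := by
    rw [hZ, hqn, hpn]
    linear_combination -(1 + C (p : ℚ) * X) * hCq
  obtain ⟨P, hP, h⟩ := main (A := ℚ[X]) n hN q hq p pt e he 1 X Z (by
    intro a b hab
    have h0 := congrArg (fun f => coeff f 0) hab
    have h1 := congrArg (fun f => coeff f 1) hab
    have ha : ((a : ℤ) : ℚ[X]) = C (a : ℚ) := by simp
    have hb : ((b : ℤ) : ℚ[X]) = C (b : ℚ) := by simp
    simp only [ha, hb, coeff_add, coeff_C_mul, coeff_one, coeff_X, coeff_zero] at h0 h1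
    norm_num at h0 h1
    exact ⟨h0, h1⟩) hX (Lq q) ⟨C (q : ℤ) * (X : ℤ[X]), by simp⟩ ⟨1 + C p * (X : ℤ[X]), by
      rw [hZ, ← mul_assoc, hCq]; simp⟩
  obtain ⟨g, hg⟩ := Lq_pow q n P hP
  have hW : (pt : ℚ[X]) * Z - (e : ℚ[X]) * X = C (q : ℚ)⁻¹ * (X + C (pt : ℚ)) := by
    have h1 : C (q : ℚ) * ((pt : ℚ[X]) * Z - (e : ℚ[X]) * X) = X + C (pt : ℚ) := by
      have he' : (p : ℚ[X]) * pt - q * e = 1 := by exact_mod_cast congrArg (Int.cast : ℤ → ℚ[X]) he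
      rw [hqn, hpn, hptn] at he'
      rw [hZ, hptn]
      linear_combination C (pt : ℚ) * (1 + C (p : ℚ) * X) * hCq + X * he'
    rw [← h1]
    linear_combination -((pt : ℚ[X]) * Z - (e : ℚ[X]) * X) * hCq
  rw [hW, hZ, mul_pow, mul_pow] at h
  have hcomp : (1 + C (p : ℚ) * X) ^ (n + 1) = ((1 + X : ℚ[X]) ^ (n + 1)).comp (C (p : ℚ) * X) := by
    simp
  have hc := congrArg (fun f => coeff f (k + 1)) h
  have hD : coeff (D (n + 2) p q (1 : ℚ[X]) X) (k + 1) =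
      (n + 2).choose i * sQ i (k + 1) p q := by
    rw [D, finsetSum_coeff, sum_eq_single (i, k + 1)]
    · simp only [one_pow, mul_one, algebraMap_eq, coeff_C_mul, coeff_X_pow, if_true]
    · intro b hb hne
      rw [HasAntidiagonal.mem_antidiagonal] at hb
      have : k + 1 ≠ b.2 := by
        intro hk
        apply hne
        ext
        · simp; omega
        · simp; omega
      simp only [one_pow, mul_one, algebraMap_eq, coeff_C_mul, coeff_X_pow, if_neg this, mul_zero]
    · intro hn
      exfalso; apply hn
      rw [HasAntidiagonal.mem_antidiagonal]; simp; omega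
  rw [← map_intCast (C : ℚ →+* ℚ[X]), hcomp, ← C_pow] at hc
  simp only [algebraMap_eq, coeff_C_mul, coeff_add, one_mul, coeff_X_mul, hD,
    coeff_X_add_C_pow, comp_C_mul_X_coeff, coeff_one_add_X_pow] at hc
  have hgk : (q : ℚ) ^ n * coeff P k = (coeff g k : ℤ) := by
    have := congrArg (fun f => coeff f k) hg
    simp only [← C_pow, coeff_C_mul, coeff_map] at this
    rw [this]; simp
  refine ⟨coeff g k, ?_⟩
  rw [← hgk]
  have e1 : n + 1 - k = i := by omega
  have e2 : (n + 1).choose k = (n + 1).choose i := (Nat.choose_symm_of_eq_add (by omega))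
  rw [e1, e2] at hc
  push_cast at hc
  have e3 : (q : ℚ) ^ n * ((q : ℚ)⁻¹) ^ (n + 1) = (q : ℚ)⁻¹ := by
    rw [pow_succ, ← mul_assoc, ← mul_pow, mul_inv_cancel₀ hq', one_pow, one_mul]
  rw [div_eq_mul_inv]
  linear_combination (q : ℚ) ^ n * hc + (_root_.bernoulli (n + 2)).num * rLcm (n + 2) *
        ((n + 1).choose i * (pt : ℚ) ^ i + (n + 1).choose (k + 1) * (p : ℚ) ^ (k + 1)) * e3

theorem pB_eq (m : ℕ) (x : ℚ) (h : ¬ (m = 1 ∧ Int.fract x = 0)) :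
    periodicBernoulli m (x : ℝ) = (((Polynomial.bernoulli m).eval (Int.fract x) : ℚ) : ℝ) := by
  have hf : Int.fract (x : ℝ) = ((Int.fract x : ℚ) : ℝ) := (Rat.cast_fract x).symm
  rw [periodicBernoulli, hf, if_neg (by rw [Rat.cast_eq_zero]; exact h)]
  rw [Polynomial.eval_map_algebraMap, ← eq_ratCast (algebraMap ℚ ℝ),
    Polynomial.aeval_algebraMap_apply]
  simp

theorem pB_one : periodicBernoulli 1 0 = 0 := by simp [periodicBernoulli]

theorem gen_eq (i j p q : ℕ) (hq : 0 < q) (hcop : Nat.Coprime p q) (hi : 1 ≤ i) (hj : 1 ≤ j)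
    (hN : Even (i + j)) : genDedekindSum i j p q =
      ((sQ i j p q - if i = 1 ∧ j = 1 then 1 / 4 else 0 : ℚ) : ℝ) := by
  obtain ⟨q, rfl⟩ : ∃ r, q = r + 1 := ⟨q - 1, by omega⟩
  rw [genDedekindSum, sQ, sum_range_succ', sum_range_succ', add_sub_assoc, Rat.cast_add,
    Rat.cast_sum]
  congr 1
  · refine sum_congr rfl fun k hk => ?_
    have hk := mem_range.1 hk
    have hq' : ((q + 1 : ℕ) : ℚ) ≠ 0 := by positivity
    have c1 : ((k + 1 : ℕ) : ℝ) / ((q + 1 : ℕ) : ℝ) =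
      ((((k + 1 : ℕ) : ℚ) / ((q + 1 : ℕ) : ℚ) : ℚ) : ℝ) := by push_cast; rfl
    have c2 : (p : ℝ) * ((k + 1 : ℕ) : ℝ) / ((q + 1 : ℕ) : ℝ) =
      (((((p : ℤ) : ℚ) * ((k + 1 : ℕ) : ℚ)) / ((q + 1 : ℕ) : ℚ) : ℚ) : ℝ) := by push_cast; rfl
    rw [c1, c2, pB_eq, pB_eq, Rat.cast_mul]
    · rintro ⟨-, h⟩
      rw [Int.fract_eq_zero_iff] at h
      obtain ⟨z, hz⟩ := h
      rw [eq_div_iff hq'] at hz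
      have hz' : z * ((q + 1 : ℕ) : ℤ) = (p : ℤ) * ((k + 1 : ℕ) : ℤ) := by exact_mod_cast hz
      have hd : (q + 1) ∣ p * (k + 1) := by
        have : ((q + 1 : ℕ) : ℤ) ∣ ((p * (k + 1) : ℕ) : ℤ) :=
          ⟨z, by push_cast at hz' ⊢; linarith⟩
        exact_mod_cast this
      have hd2 := Nat.le_of_dvd (by omega) (hcop.symm.dvd_of_dvd_mul_left hd)
      omega
    · rintro ⟨-, h⟩
      rw [fract_small _ _ (by omega), div_eq_zero_iff] at h
      rcases h with h | h
      · norm_cast at h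
      · exact hq' h
  · simp only [Nat.cast_zero, mul_zero, zero_div, Int.fract_zero, Polynomial.bernoulli_eval_zero]
    have h0 : ((0 : ℚ) : ℝ) = 0 := Rat.cast_zero
    by_cases h1 : i = 1
    · subst h1
      rw [pB_one, zero_mul]
      by_cases h2 : j = 1
      · subst h2; norm_num [bernoulli_one]
      · have ho : Odd j := by rw [Nat.even_iff] at hN; rw [Nat.odd_iff]; omega
        rw [bernoulli_eq_zero_of_odd ho (by omega)]; simp [h2]
    · by_cases h2 : j = 1
      · subst h2
        have ho : Odd i := by rw [Nat.even_iff] at hN; rw [Nat.odd_iff]; omega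
        rw [bernoulli_eq_zero_of_odd ho (by omega), pB_one]; simp [h1]
      · rw [← h0, pB_eq _ _ (by tauto), pB_eq _ _ (by tauto)]
        simp [h1, Polynomial.bernoulli_eval_zero]

end Final

end JunLee

/-- Jun–Lee: the fractional part of `R_N q^{N-2} s_{i,j}(p,q)` is
`α_N r_N (C(N-1,i) p'^i + C(N-1,j) p^j)/q`, where `R_N = C(N,i) β_N r_N`,
`B_N = α_N / β_N` in lowest terms, and `p p' ≡ 1 (mod q)`. -/
theorem junLee_fractional_part (p q i j : ℕ) (hp : 0 < p) (hpq : p < q)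
    (hcop : Nat.Coprime p q) (hi : 1 ≤ i) (hj : 1 ≤ j) (hN2 : 2 ≤ i + j)
    (hNeven : Even (i + j)) (p' : ℤ) (hp' : ((p : ℤ) * p') % q = 1 % q) :
    ∃ m : ℤ,
      (((i + j).choose i : ℝ) * ((bernoulli (i + j)).den : ℝ) * (rLcm (i + j) : ℝ)) *
          (q : ℝ)^(i + j - 2) * genDedekindSum i j p q -
        ((bernoulli (i + j)).num : ℝ) * (rLcm (i + j) : ℝ) *
          (((i + j - 1).choose i : ℝ) * (p' : ℝ)^i +
            ((i + j - 1).choose j : ℝ) * (p : ℝ)^j) / q = (m : ℝ) := by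
  obtain ⟨k, rfl⟩ : ∃ k, j = k + 1 := ⟨j - 1, by omega⟩
  obtain ⟨n, hn⟩ : ∃ n, i + (k + 1) = n + 2 := ⟨i + k - 1, by omega⟩
  have hq : 0 < q := by omega
  obtain ⟨m, hm⟩ := JunLee.final_rat n i k q p p' (by rwa [hn] at hNeven) hq (by omega) hp'
  rw [JunLee.gen_eq i (k + 1) p q hq hcop hi hj hNeven, hn]
  have e1 : n + 2 - 2 = n := rfl
  have e2 : n + 2 - 1 = n + 1 := rfl
  rw [e1, e2]
  have hm' := congrArg (Rat.cast : ℚ → ℝ) hm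
  push_cast at hm'
  by_cases h : i = 1 ∧ k + 1 = 1
  · have hn0 : n = 0 := by omega
    have hk0 : k = 0 := by omega
    obtain ⟨rfl, -⟩ := h
    subst hn0 hk0
    have hden : (bernoulli 2).den = 6 := by
      rw [bernoulli_two]; norm_num
    refine ⟨m - 3 * rLcm 2, ?_⟩
    norm_num [hden] at hm' ⊢
    linear_combination hm'
  · refine ⟨m, ?_⟩
    rw [if_neg h, ← hm']
    push_cast
    ring
end
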